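/- Let K > 0 be a real number and let g : ℝ → ℝ be any function satisfying g(Φ(x)) = 1 − K·x² for all x < 0, where Φ is the standard Gaussian CDF. Then g is strictly concave on the open interval (0, 1/2). -/

import Mathlib

open MeasureTheory ProbabilityTheory

/-- The standard Gaussian CDF is the integral of the Gaussian density. -/
lemma cdf_gaussianReal_eq_integral (x : ℝ) :
    cdf (gaussianReal 0 1) x = ∫ t in Set.Iic x, gaussianPDFReal 0 1 t := by
  rw [cdf_eq_real, measureReal_def, gaussianReal_apply_eq_integral _ one_ne_zero,
    ENNReal.toReal_ofReal (integral_nonneg (gaussianPDFReal_nonneg 0 1))]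

lemma continuous_gaussianPDFReal_zero_one : Continuous (gaussianPDFReal 0 1) := by
  unfold gaussianPDFReal
  fun_prop

lemma hasDerivAt_cdf_gaussianReal (x : ℝ) :
    HasDerivAt (cdf (gaussianReal 0 1)) (gaussianPDFReal 0 1 x) x := by
  have hint := integrable_gaussianPDFReal 0 1
  have h : ⇑(cdf (gaussianReal 0 1)) =
      fun y ↦ (∫ t in (0 : ℝ)..y, gaussianPDFReal 0 1 t) + cdf (gaussianReal 0 1) 0 := by
    funext y
    rw [cdf_gaussianReal_eq_integral, cdf_gaussianReal_eq_integral,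
      ← intervalIntegral.integral_Iic_sub_Iic hint.integrableOn hint.integrableOn,
      sub_add_cancel]
  rw [h]
  exact (intervalIntegral.integral_hasDerivAt_right hint.intervalIntegrable
    (stronglyMeasurable_gaussianPDFReal 0 1).stronglyMeasurableAtFilter
    continuous_gaussianPDFReal_zero_one.continuousAt).add_const _

lemma continuous_cdf_gaussianReal : Continuous (cdf (gaussianReal 0 1)) :=
  continuous_iff_continuousAt.2 fun x ↦ (hasDerivAt_cdf_gaussianReal x).continuousAt

lemma strictMono_cdf_gaussianReal : StrictMono (cdf (gaussianReal 0 1)) :=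
  strictMono_of_deriv_pos fun x ↦ by
    rw [(hasDerivAt_cdf_gaussianReal x).deriv]
    exact gaussianPDFReal_pos 0 1 x one_ne_zero

lemma cdf_gaussianReal_zero : cdf (gaussianReal 0 1) 0 = 1 / 2 := by
  have hint := integrable_gaussianPDFReal 0 1
  have hsum := intervalIntegral.integral_Iic_add_Ioi (b := (0 : ℝ))
    hint.integrableOn hint.integrableOn
  have hsymm := integral_comp_neg_Iic 0 (gaussianPDFReal 0 1)
  have heven (t : ℝ) : gaussianPDFReal 0 1 (-t) = gaussianPDFReal 0 1 t := by
    simp [gaussianPDFReal]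
  simp only [heven, neg_zero] at hsymm
  rw [integral_gaussianPDFReal_eq_one 0 one_ne_zero, ← hsymm] at hsum
  rw [cdf_gaussianReal_eq_integral]
  linarith

lemma exists_neg_cdf_gaussianReal_eq {p : ℝ} (hp : p ∈ Set.Ioo (0 : ℝ) (1 / 2)) :
    ∃ x < 0, cdf (gaussianReal 0 1) x = p := by
  obtain ⟨a, ha⟩ := ((tendsto_cdf_atBot (gaussianReal 0 1)).eventually_lt_const hp.1).exists
  obtain ⟨x, hx⟩ := mem_range_of_exists_le_of_exists_ge continuous_cdf_gaussianReal
    ⟨a, ha.le⟩ ⟨0, by rw [cdf_gaussianReal_zero]; exact hp.2.le⟩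
  refine ⟨x, strictMono_cdf_gaussianReal.lt_iff_lt.1 ?_, hx⟩
  rw [hx, cdf_gaussianReal_zero]
  exact hp.2

lemma strictMonoOn_gaussianPDFReal : StrictMonoOn (gaussianPDFReal 0 1) (Set.Iic 0) := by
  intro x _ y (hy : y ≤ 0) hxy
  simp only [gaussianPDFReal]
  have : y ^ 2 < x ^ 2 := by nlinarith
  gcongr ?_ * Real.exp ?_
  simp only [sub_zero, NNReal.coe_one]
  linarith

/-- A curve parametrized by `(u, f)` is strictly concave when the ratio `f' / u'` of the
derivatives strictly decreases along the parameter. -/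
lemma strictConcaveOn_of_parametric {s t : Set ℝ} {g u f u' f' : ℝ → ℝ} (hs : Convex ℝ s)
    (ht : t.OrdConnected) (hu_mono : StrictMonoOn u t) (hsurj : Set.SurjOn u t s)
    (hg : ∀ x ∈ t, g (u x) = f x)
    (hu : ∀ x ∈ t, HasDerivAt u (u' x) x) (hf : ∀ x ∈ t, HasDerivAt f (f' x) x)
    (hu' : ∀ x ∈ t, 0 < u' x) (hratio : StrictAntiOn (fun x ↦ f' x / u' x) t) :
    StrictConcaveOn ℝ s g := by
  have hslope {a b : ℝ} (ha : a ∈ t) (hb : b ∈ t) (hab : a < b) :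
      ∃ c ∈ Set.Ioo a b, c ∈ t ∧ (g (u b) - g (u a)) / (u b - u a) = f' c / u' c := by
    have hsub : Set.Icc a b ⊆ t := ht.out ha hb
    have hsub' := Set.Ioo_subset_Icc_self.trans hsub
    obtain ⟨c, hc, h⟩ := exists_ratio_hasDerivAt_eq_ratio_slope f f' hab
      (fun x hx ↦ (hf x (hsub hx)).continuousAt.continuousWithinAt)
      (fun x hx ↦ hf x (hsub' hx)) u u'
      (fun x hx ↦ (hu x (hsub hx)).continuousAt.continuousWithinAt)
      (fun x hx ↦ hu x (hsub' hx))
    refine ⟨c, hc, hsub' hc, ?_⟩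
    rw [hg b hb, hg a ha, div_eq_div_iff (sub_pos.2 (hu_mono ha hb hab)).ne'
      (hu' c (hsub' hc)).ne']
    linarith
  refine strictConcaveOn_of_slope_strict_anti_adjacent hs fun {p q r} hp hr hpq hqr ↦ ?_
  have hq : q ∈ s := hs.ordConnected.out hp hr ⟨hpq.le, hqr.le⟩
  obtain ⟨x, hx, rfl⟩ := hsurj hp
  obtain ⟨y, hy, rfl⟩ := hsurj hq
  obtain ⟨z, hz, rfl⟩ := hsurj hr
  obtain ⟨c, hc, hct, hc'⟩ := hslope hx hy ((hu_mono.lt_iff_lt hx hy).1 hpq)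
  obtain ⟨d, hd, hdt, hd'⟩ := hslope hy hz ((hu_mono.lt_iff_lt hy hz).1 hqr)
  rw [hc', hd']
  exact hratio hct hdt (hc.2.trans hd.1)

/-- Any function `g` with `g(Φ(x)) = 1 − Kx²` for all `x < 0` (K > 0) is
strictly concave on `(0, 1/2)`. -/
theorem adjusted_correlation_strictConcave
    (K : ℝ) (hK : 0 < K)
    (g : ℝ → ℝ) (hg : ∀ x < (0 : ℝ), g (cdf (gaussianReal 0 1) x) = 1 - K * x ^ 2) :
    StrictConcaveOn ℝ (Set.Ioo (0 : ℝ) (1 / 2)) g := by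
  refine strictConcaveOn_of_parametric (t := Set.Iio 0) (f := fun x ↦ 1 - K * x ^ 2)
    (f' := fun x ↦ K * (2 * -x)) (convex_Ioo _ _) Set.ordConnected_Iio
    (strictMono_cdf_gaussianReal.strictMonoOn _) (fun p hp ↦ exists_neg_cdf_gaussianReal_eq hp)
    hg (fun x _ ↦ hasDerivAt_cdf_gaussianReal x) (fun x _ ↦ ?_)
    (fun x _ ↦ gaussianPDFReal_pos 0 1 x one_ne_zero) ?_
  · exact (((hasDerivAt_pow 2 x).const_mul K).const_sub 1).congr_deriv (by simp)
  · intro x (hx : x < 0) y (hy : y < 0) hxy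
    have hpdf := strictMonoOn_gaussianPDFReal hx.le hy.le hxy
    have hpos := gaussianPDFReal_pos 0 1 x one_ne_zero
    exact div_lt_div₀ (by nlinarith) hpdf.le (by nlinarith) hpos
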